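/- Let α = α₁ + α₂u + α₃v + α₄uv be a non-square unit of R = F_{p^m}[u,v]/⟨u², v², uv−vu⟩ (α₁, α₂, α₃ ∈ F_{p^m}^*) and C = ⟨u(x² − α₀)^ℓ⟩ with p^s + 1 ≤ ℓ ≤ 2p^s − 1. Then C = uv·⟨(x² − α₀)^{ℓ − p^s}⟩ where the latter is the ideal generated by (x² − α₀)^{ℓ−p^s} in F_{p^m}[x]/⟨x^{2p^s} − α₁⟩ embedded via multiplication by uv, and consequently d_H(C) equals the Hamming distance of the constacyclic code ⟨(x² − α₀)^{ℓ−p^s}⟩ ⊆ F_{p^m}[x]/⟨x^{2p^s} − α₁⟩. -/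

import Mathlib

set_option synthInstance.maxHeartbeats 1000000
set_option maxHeartbeats 1000000

open TrivSqZeroExt Polynomial

/-- The ring `R = F_{p^m}[u,v]/⟨u², v², uv - vu⟩`, modeled as dual numbers over
dual numbers: the outer `ε` plays the role of `u`, the inner one of `v`. -/
abbrev Rring (F : Type*) [Field F] : Type _ := DualNumber (DualNumber F)

/-- The element `u` of `R`. -/
noncomputable def uElem (F : Type*) [Field F] : Rring F := inr 1

/-- The element `v` of `R`. -/
noncomputable def vElem (F : Type*) [Field F] : Rring F := inl (inr 1)

/-- The embedding of the field `F` into `R`. -/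
noncomputable def cF {F : Type*} [Field F] (a : F) : Rring F := inl (inl a)

/-- The polynomial representation of a coefficient vector in `R[x]/⟨f⟩`. -/
noncomputable def vecToQ {R : Type*} [CommRing R] (f : R[X]) {n : ℕ} (c : Fin n → R) :
    AdjoinRoot f :=
  ∑ i : Fin n, AdjoinRoot.of f (c i) * AdjoinRoot.root f ^ (i : ℕ)

/-- The Hamming weight of a coefficient vector. -/
noncomputable def wtH {R : Type*} [Zero R] {n : ℕ} (c : Fin n → R) : ℕ :=
  {i : Fin n | c i ≠ 0}.ncard

/-- The minimum Hamming distance of a linear code given as an ideal of `R[x]/⟨f⟩`,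
codewords being identified with coefficient vectors of length `n`. -/
noncomputable def dHam {R : Type*} [CommRing R] (f : R[X]) (n : ℕ)
    (I : Ideal (AdjoinRoot f)) : ℕ :=
  sInf {w : ℕ | ∃ c : Fin n → R, c ≠ 0 ∧ vecToQ f c ∈ I ∧ w = wtH c}

/-- Every element of `R[x]/⟨f⟩` with `f` monic of degree `n` has a unique coefficient vector
of length `n`. -/
theorem vecToQ_bijective {R : Type*} [CommRing R] {f : R[X]} (hf : f.Monic) {n : ℕ}
    (hn : f.natDegree = n) : Function.Bijective (vecToQ f (n := n)) := by
  subst hn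
  have h : vecToQ f (n := f.natDegree) =
      (AdjoinRoot.powerBasis' hf).basis.equivFun.symm := by
    funext c
    refine .trans ?_ ((AdjoinRoot.powerBasis' hf).basis.equivFun_symm_apply c).symm
    refine Finset.sum_congr rfl fun i _ => ?_
    exact ((congrArg (c i • ·) ((AdjoinRoot.powerBasis' hf).basis_eq_pow i)).trans
      (Algebra.smul_def _ _)).symm
  rw [h]
  exact LinearEquiv.bijective _

theorem vecToQ_const_mul {R : Type*} [CommRing R] (f : R[X]) {n : ℕ} (r : R) (c : Fin n → R) :
    vecToQ f (fun i => r * c i) = AdjoinRoot.of f r * vecToQ f c := by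
  simp only [vecToQ, map_mul, Finset.mul_sum, mul_assoc]

theorem map_vecToQ {R S : Type*} [CommRing R] [CommRing S] (φ : R →+* S) {f : R[X]} {g : S[X]}
    (h : g ∣ f.map φ) {n : ℕ} (c : Fin n → R) :
    AdjoinRoot.map φ f g h (vecToQ f c) = vecToQ g (fun i => φ (c i)) := by
  simp [vecToQ]

theorem wtH_comp {R S : Type*} [Zero R] [Zero S] {φ : R → S} (h : ∀ a, φ a = 0 ↔ a = 0) {n : ℕ}
    (c : Fin n → R) : wtH (fun i => φ (c i)) = wtH c := by
  simp only [wtH, ne_eq, h]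

section Socle

variable {A F : Type*} [CommRing A] [Field F] {π : A →+* F} {σ : F →+* A} {w : A}

/-- If the annihilator of `w` is the kernel of `π`, two elements of `A[x]/⟨f⟩` with the same
reduction have the same product with `w`. -/
theorem of_mul_eq_of_map_eq (hw : ∀ r, w * r = 0 ↔ π r = 0) {f : A[X]} (hf : f.Monic)
    {g : F[X]} (hg : g.Monic) (hfg : g ∣ f.map π) (hdeg : g.natDegree = f.natDegree)
    {s t : AdjoinRoot f} (h : AdjoinRoot.map π f g hfg s = AdjoinRoot.map π f g hfg t) :
    AdjoinRoot.of f w * s = AdjoinRoot.of f w * t := by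
  obtain ⟨c, rfl⟩ := (vecToQ_bijective hf rfl).2 s
  obtain ⟨d, rfl⟩ := (vecToQ_bijective hf rfl).2 t
  rw [map_vecToQ, map_vecToQ] at h
  have hcd := (vecToQ_bijective hg hdeg).1 h
  rw [← vecToQ_const_mul, ← vecToQ_const_mul]
  congr 1
  funext i
  rw [← sub_eq_zero, ← mul_sub, hw, map_sub, sub_eq_zero, congrFun hcd i]

/-- If the annihilator of `w` is the kernel of `π`, the codewords of `⟨w y⟩` are the
`w`-multiples of the codewords of the code generated by the reduction of `y`. -/
theorem vecToQ_mem_span_of_mul_iff (hσ : ∀ a, π (σ a) = a) (hw : ∀ r, w * r = 0 ↔ π r = 0)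
    {f : A[X]} (hf : f.Monic) {g : F[X]} (hg : g.Monic) (hfg : g ∣ f.map π) {n : ℕ}
    (hfn : f.natDegree = n) (hgn : g.natDegree = n) (y : AdjoinRoot f) (c : Fin n → A) :
    vecToQ f c ∈ Ideal.span {AdjoinRoot.of f w * y} ↔
      ∃ d : Fin n → F, vecToQ g d ∈ Ideal.span {AdjoinRoot.map π f g hfg y} ∧
        c = fun i => w * σ (d i) := by
  have hlift (d : Fin n → F) :
      AdjoinRoot.map π f g hfg (vecToQ f fun i => σ (d i)) = vecToQ g d := by
    simp only [map_vecToQ, hσ]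
  simp only [Ideal.mem_span_singleton']
  constructor
  · rintro ⟨t, ht⟩
    obtain ⟨d, hd⟩ := (vecToQ_bijective hg hgn).2 (AdjoinRoot.map π f g hfg (t * y))
    refine ⟨d, ⟨_, by rw [hd, map_mul]⟩, (vecToQ_bijective hf hfn).1 ?_⟩
    rw [vecToQ_const_mul, of_mul_eq_of_map_eq hw hf hg hfg (hgn.trans hfn.symm)
      ((hlift d).trans hd), ← ht]
    ring
  · rintro ⟨d, ⟨t, ht⟩, rfl⟩
    obtain ⟨e, rfl⟩ := (vecToQ_bijective hg hgn).2 t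
    refine ⟨vecToQ f fun i => σ (e i), ?_⟩
    rw [vecToQ_const_mul, of_mul_eq_of_map_eq hw hf hg hfg (hgn.trans hfn.symm)
      (s := vecToQ f fun i => σ (d i)) (t := (vecToQ f fun i => σ (e i)) * y)
      (by rw [map_mul, hlift, hlift, ht])]
    ring

/-- Multiplication by `w` preserves Hamming weights of codewords over `F`, hence distances. -/
theorem dHam_eq_of_mem_iff (hσ : ∀ a, π (σ a) = a) (hw : ∀ r, w * r = 0 ↔ π r = 0)
    {f : A[X]} {g : F[X]} {n : ℕ} {I : Ideal (AdjoinRoot f)} {J : Ideal (AdjoinRoot g)}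
    (h : ∀ c : Fin n → A, vecToQ f c ∈ I ↔
      ∃ d : Fin n → F, vecToQ g d ∈ J ∧ c = fun i => w * σ (d i)) :
    dHam f n I = dHam g n J := by
  have hzero (a : F) : w * σ a = 0 ↔ a = 0 := by rw [hw, hσ]
  refine congrArg sInf (Set.ext fun k => ⟨?_, ?_⟩)
  · rintro ⟨c, hc, hmem, rfl⟩
    obtain ⟨d, hd, rfl⟩ := (h c).1 hmem
    exact ⟨d, fun h0 => hc (funext fun i => (hzero _).2 (congrFun h0 i)), hd, wtH_comp hzero d⟩
  · rintro ⟨d, hd, hmem, rfl⟩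
    exact ⟨_, fun h0 => hd (funext fun i => (hzero _).1 (congrFun h0 i)),
      (h _).2 ⟨d, hmem, rfl⟩, (wtH_comp hzero d).symm⟩

end Socle

/-- Since `u (x² - α₀)^{p^s} = α₃ uv` with `α₃` a unit, the ideal `⟨u (x² - α₀)^ℓ⟩` equals
`⟨uv (x² - α₀)^{ℓ - p^s}⟩`. -/
theorem span_mul_pow_eq {p s : ℕ} (hp : p.Prime) {A F : Type*} [CommRing A] [CharP A p] [Field F]
    (σ : F →+* A) {u : A} (v : A) (huu : u * u = 0) {α₀ α₁ α₂ α₃ α₄ : F} (hα₃ : α₃ ≠ 0)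
    (h0 : α₀ ^ p ^ s = α₁) {ℓ : ℕ} (hℓ : p ^ s ≤ ℓ) {f : A[X]}
    (hf : f = X ^ (2 * p ^ s) - C (σ α₁ + σ α₂ * u + σ α₃ * v + σ α₄ * (u * v))) :
    Ideal.span {AdjoinRoot.of f u * (AdjoinRoot.root f ^ 2 - AdjoinRoot.of f (σ α₀)) ^ ℓ} =
      Ideal.span {AdjoinRoot.of f (u * v) *
        (AdjoinRoot.root f ^ 2 - AdjoinRoot.of f (σ α₀)) ^ (ℓ - p ^ s)} := by
  have := Fact.mk hp
  have hroot : AdjoinRoot.root f ^ (2 * p ^ s) =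
      AdjoinRoot.of f (σ α₁ + σ α₂ * u + σ α₃ * v + σ α₄ * (u * v)) := by
    have h : AdjoinRoot.mk f
        (X ^ (2 * p ^ s) - C (σ α₁ + σ α₂ * u + σ α₃ * v + σ α₄ * (u * v))) = 0 :=
      AdjoinRoot.mk_eq_zero.2 (dvd_of_eq hf)
    rwa [map_sub, map_pow, AdjoinRoot.mk_X, AdjoinRoot.mk_C, sub_eq_zero] at h
  have hfrob : (AdjoinRoot.root f ^ 2 - AdjoinRoot.of f (σ α₀)) ^ p ^ s =
      AdjoinRoot.of f (σ α₂ * u + σ α₃ * v + σ α₄ * (u * v)) := by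
    have h := congrArg (AdjoinRoot.mk f)
      (sub_pow_char_pow (p := p) (n := s) (X ^ 2 : A[X]) (C (σ α₀)))
    simp only [map_pow, map_sub, AdjoinRoot.mk_X, AdjoinRoot.mk_C] at h
    rw [h, ← pow_mul, hroot, ← map_pow, ← map_pow, h0, ← map_sub]
    congr 1
    ring
  have hmul : AdjoinRoot.of f u * (AdjoinRoot.root f ^ 2 - AdjoinRoot.of f (σ α₀)) ^ ℓ =
      AdjoinRoot.of f (u * v) * (AdjoinRoot.root f ^ 2 - AdjoinRoot.of f (σ α₀)) ^ (ℓ - p ^ s) *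
        AdjoinRoot.of f (σ α₃) := by
    have hu : u * (σ α₂ * u + σ α₃ * v + σ α₄ * (u * v)) = u * v * σ α₃ := by
      linear_combination (σ α₂ + σ α₄ * v) * huu
    nth_rw 1 [← Nat.add_sub_cancel' hℓ]
    rw [pow_add, hfrob, ← mul_assoc, ← map_mul, hu, map_mul]
    ring
  rw [hmul, Ideal.span_singleton_mul_right_unit ((hα₃.isUnit.map σ).map (AdjoinRoot.of f))]

/-- The description of `⟨u (x² - α₀)^ℓ⟩` over any ring `A` with residue field `F`, where
`σ : F →+* A` splits the reduction `π` and the annihilator of `uv` is the kernel of `π`. -/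
theorem code_eq_uv_mul_code {p s : ℕ} (hp : p.Prime) {A F : Type*} [CommRing A] [CharP A p]
    [Field F] {π : A →+* F} (σ : F →+* A) (hσ : ∀ a, π (σ a) = a) {u v : A}
    (hu : π u = 0) (hv : π v = 0) (huu : u * u = 0) (huv : ∀ r, u * v * r = 0 ↔ π r = 0)
    {α₀ α₁ α₂ α₃ α₄ : F} (hα₃ : α₃ ≠ 0) (h0 : α₀ ^ p ^ s = α₁) {ℓ : ℕ} (hℓ : p ^ s ≤ ℓ)
    {f : A[X]} (hf : f = X ^ (2 * p ^ s) - C (σ α₁ + σ α₂ * u + σ α₃ * v + σ α₄ * (u * v)))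
    (c : Fin (2 * p ^ s) → A) :
    vecToQ f c ∈ Ideal.span
        {AdjoinRoot.of f u * (AdjoinRoot.root f ^ 2 - AdjoinRoot.of f (σ α₀)) ^ ℓ} ↔
      ∃ d : Fin (2 * p ^ s) → F,
        vecToQ ((X : F[X]) ^ (2 * p ^ s) - C α₁) d ∈
          Ideal.span {(AdjoinRoot.root ((X : F[X]) ^ (2 * p ^ s) - C α₁) ^ 2 -
            AdjoinRoot.of _ α₀) ^ (ℓ - p ^ s)} ∧
        c = fun i => u * v * σ (d i) := by
  have := π.domain_nontrivial
  have hN : 2 * p ^ s ≠ 0 := mul_ne_zero two_ne_zero (pow_ne_zero _ hp.ne_zero)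
  rw [span_mul_pow_eq hp σ v huu hα₃ h0 hℓ hf]
  have hfg : X ^ (2 * p ^ s) - C α₁ ∣ f.map π := by
    simp [hf, hσ, hu, hv]
  have key := vecToQ_mem_span_of_mul_iff hσ huv (hf ▸ monic_X_pow_sub_C _ hN)
    (monic_X_pow_sub_C α₁ hN) hfg (hf ▸ natDegree_X_pow_sub_C) natDegree_X_pow_sub_C
    ((AdjoinRoot.root _ ^ 2 - AdjoinRoot.of _ (σ α₀)) ^ (ℓ - p ^ s)) c
  simpa only [map_pow, map_sub, AdjoinRoot.map_root, AdjoinRoot.map_of, hσ] using key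

/-- The reduction of `R` modulo its maximal ideal `⟨u, v⟩`. -/
noncomputable def residueHom (F : Type*) [Field F] : Rring F →+* F :=
  (fstHom F F F).toRingHom.comp (fstHom (DualNumber F) (DualNumber F) (DualNumber F)).toRingHom

theorem residueHom_apply {F : Type*} [Field F] (r : Rring F) : residueHom F r = r.fst.fst := rfl

/-- The embedding `cF` as a ring homomorphism. -/
noncomputable def cFHom (F : Type*) [Field F] : F →+* Rring F :=
  (inlHom (DualNumber F) (DualNumber F)).comp (inlHom F F)

theorem uElem_mul_vElem_mul {F : Type*} [Field F] (r : Rring F) :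
    uElem F * vElem F * r = inr (inr (residueHom F r)) := by
  ext <;> simp [uElem, vElem, residueHom_apply]

theorem uElem_mul_vElem_mul_eq_zero {F : Type*} [Field F] (r : Rring F) :
    uElem F * vElem F * r = 0 ↔ residueHom F r = 0 := by
  rw [uElem_mul_vElem_mul]
  exact ⟨fun h => congrArg (fun x : Rring F => x.snd.snd) h, fun h => by rw [h, inr_zero, inr_zero]⟩

/-- with `α = α₁ + α₂u + α₃v + α₄uv` a non-square unit of `R` and
`p^s + 1 ≤ ℓ ≤ 2p^s − 1`, the code `C = ⟨u(x² − α₀)^ℓ⟩ ⊆ R[x]/⟨x^{2p^s} − α⟩` consists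
exactly of the codewords `uv·f(x)` with `f` ranging over the constacyclic code
`D = ⟨(x² − α₀)^{ℓ−p^s}⟩ ⊆ F_{p^m}[x]/⟨x^{2p^s} − α₁⟩` (coefficientwise multiplication
by `uv`), and consequently `d_H(C) = d_H(D)`. -/
theorem stmt15 {p m s : ℕ} (hp : p.Prime) (hodd : p ≠ 2) (hm : 0 < m) (hs : 0 < s)
    {F : Type*} [Field F] [Fintype F] [CharP F p] (hF : Fintype.card F = p ^ m)
    (α₀ α₁ α₂ α₃ α₄ : F) (hα₁ : α₁ ≠ 0) (hα₂ : α₂ ≠ 0) (hα₃ : α₃ ≠ 0)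
    (h0 : α₀ ^ p ^ s = α₁)
    (hns : ¬ IsSquare (cF α₁ + cF α₂ * uElem F + cF α₃ * vElem F + cF α₄ * (uElem F * vElem F)))
    (ℓ : ℕ) (hℓ1 : p ^ s + 1 ≤ ℓ) (hℓ2 : ℓ ≤ 2 * p ^ s - 1) :
    (∀ c : Fin (2 * p ^ s) → Rring F,
      vecToQ ((X : (Rring F)[X]) ^ (2 * p ^ s) -
          C (cF α₁ + cF α₂ * uElem F + cF α₃ * vElem F + cF α₄ * (uElem F * vElem F))) c ∈
        Ideal.span {AdjoinRoot.of _ (uElem F) *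
          (AdjoinRoot.root ((X : (Rring F)[X]) ^ (2 * p ^ s) -
              C (cF α₁ + cF α₂ * uElem F + cF α₃ * vElem F + cF α₄ * (uElem F * vElem F))) ^ 2 -
            AdjoinRoot.of _ (cF α₀)) ^ ℓ} ↔
      ∃ d : Fin (2 * p ^ s) → F,
        vecToQ ((X : F[X]) ^ (2 * p ^ s) - C α₁) d ∈
          Ideal.span {(AdjoinRoot.root ((X : F[X]) ^ (2 * p ^ s) - C α₁) ^ 2 -
            AdjoinRoot.of _ α₀) ^ (ℓ - p ^ s)} ∧
        c = fun i => uElem F * vElem F * cF (d i)) ∧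
    dHam ((X : (Rring F)[X]) ^ (2 * p ^ s) -
        C (cF α₁ + cF α₂ * uElem F + cF α₃ * vElem F + cF α₄ * (uElem F * vElem F)))
      (2 * p ^ s)
      (Ideal.span {AdjoinRoot.of _ (uElem F) *
        (AdjoinRoot.root ((X : (Rring F)[X]) ^ (2 * p ^ s) -
            C (cF α₁ + cF α₂ * uElem F + cF α₃ * vElem F + cF α₄ * (uElem F * vElem F))) ^ 2 -
          AdjoinRoot.of _ (cF α₀)) ^ ℓ}) =
    dHam ((X : F[X]) ^ (2 * p ^ s) - C α₁) (2 * p ^ s)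
      (Ideal.span {(AdjoinRoot.root ((X : F[X]) ^ (2 * p ^ s) - C α₁) ^ 2 -
        AdjoinRoot.of _ α₀) ^ (ℓ - p ^ s)}) := by
  have : CharP (Rring F) p :=
    charP_of_injective_ringHom (f := cFHom F) (inl_injective.comp inl_injective) p
  have hσ (a : F) : residueHom F (cFHom F a) = a := rfl
  have key := code_eq_uv_mul_code hp (cFHom F) hσ (u := uElem F) (v := vElem F)
    (α₂ := α₂) (α₄ := α₄) rfl rfl (inr_mul_inr _ _ _) uElem_mul_vElem_mul_eq_zero hα₃ h0
    (by omega : p ^ s ≤ ℓ) rfl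
  exact ⟨key, dHam_eq_of_mem_iff hσ uElem_mul_vElem_mul_eq_zero key⟩
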